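/- There is an absolute constant C such that the following holds. For every sequence v₁, …, v_n of positive integers (n ≥ 1) and every positive integer t, there exists a CNF formula ψ with at most C·n·(⌈log₂ t⌉ + 1) variables and at most C·n·(⌈log₂ t⌉ + 1) clauses, together with a path decomposition of ψ of width at most ⌈log₂ t⌉ + C, such that ψ is satisfiable if and only if there exists a subset I ⊆ {1, …, n} with Σ_{i ∈ I} v_i = t. -/

import Mathlib

open scoped Classical

namespace PPSETH

abbrev Var := ℕ
abbrev Clause := Finset (Var × Bool)
abbrev CNF := List Clause

/-- The set of variables occurring in a clause. -/
def clauseVars (c : Clause) : Finset Var := c.image Prod.fst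

/-- The set of variables occurring in a CNF formula. -/
def cnfVars (φ : CNF) : Finset Var := φ.foldr (fun c s => clauseVars c ∪ s) ∅

/-- An assignment satisfies a clause if the clause contains a literal it makes true. -/
def SatC (τ : Var → Bool) (c : Clause) : Prop := ∃ l ∈ c, τ l.1 = l.2

/-- An assignment satisfies a CNF formula if it satisfies every clause. -/
def Sat (τ : Var → Bool) (φ : CNF) : Prop := ∀ c ∈ φ, SatC τ c

def Satisfiable (φ : CNF) : Prop := ∃ τ, Sat τ φ

/-- Size of a CNF formula: number of variables plus total number of literal occurrences. -/
def size (φ : CNF) : ℕ := (cnfVars φ).card + (φ.map Finset.card).sum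

/-- Weight of an assignment: the number of variables of the formula set to true. -/
def weight (φ : CNF) (τ : Var → Bool) : ℕ :=
  ((cnfVars φ).filter (fun x => τ x = true)).card

/-- The number of clauses (with multiplicity) satisfied by an assignment. -/
noncomputable def satCount (φ : CNF) (τ : Var → Bool) : ℕ :=
  (φ.map (fun c => if SatC τ c then 1 else 0)).sum

/-- Number of clauses (with multiplicity) in which a variable occurs. -/
noncomputable def occs (φ : CNF) (x : Var) : ℕ :=
  (φ.map (fun c => if x ∈ clauseVars c then 1 else 0)).sum

/-- A k-CNF formula: every clause has at most k literals. -/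
def IsKCNF (k : ℕ) (φ : CNF) : Prop := ∀ c ∈ φ, c.card ≤ k

/-- Structural conditions for a path decomposition of (the primal graph of) a CNF formula. -/
def PDOn (φ : CNF) (B : List (Finset Var)) : Prop :=
  (∀ b ∈ B, b ⊆ cnfVars φ) ∧
  (∀ x ∈ cnfVars φ, ∃ b ∈ B, x ∈ b) ∧
  (∀ c ∈ φ, ∃ b ∈ B, clauseVars c ⊆ b) ∧
  (∀ x : Var, ∀ i j k : ℕ, i ≤ j → j ≤ k →
    x ∈ B.getD i ∅ → x ∈ B.getD k ∅ → x ∈ B.getD j ∅)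

/-- A path decomposition of a CNF formula of width `p`: bags have size at most `p + 1`. -/
def PD (φ : CNF) (p : ℕ) (B : List (Finset Var)) : Prop :=
  PDOn φ B ∧ ∀ b ∈ B, b.card ≤ p + 1

/-- The clauses expressing that the values of the variables `f 0, …, f (r - 1)` satisfy `R`:
each falsifying tuple is excluded by one clause. -/
noncomputable def relClauses {r : ℕ} (R : (Fin r → Bool) → Prop) (f : Fin r → Var) : CNF :=
  (Finset.univ.filter fun a => ¬ R a).toList.map
    fun a => Finset.univ.image fun j => (f j, !a j)

theorem sat_relClauses {r : ℕ} (R : (Fin r → Bool) → Prop) (f : Fin r → Var) (τ : Var → Bool) :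
    Sat τ (relClauses R f) ↔ R (fun j => τ (f j)) := by
  constructor
  · intro h
    by_contra hR
    obtain ⟨l, hl, hτ⟩ := h (Finset.univ.image fun j => (f j, !τ (f j)))
      (List.mem_map.2 ⟨fun j => τ (f j), by simpa using hR, rfl⟩)
    obtain ⟨j, -, rfl⟩ := Finset.mem_image.1 hl
    simp at hτ
  · intro hR c hc
    obtain ⟨a, ha, rfl⟩ := List.mem_map.1 hc
    have hne : (fun j => τ (f j)) ≠ a := by
      rintro rfl
      simp [hR] at ha
    obtain ⟨j, hj⟩ := Function.ne_iff.1 hne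
    exact ⟨(f j, !a j), Finset.mem_image_of_mem _ (Finset.mem_univ j), Bool.eq_not.2 hj⟩

theorem length_relClauses_le {r : ℕ} (R : (Fin r → Bool) → Prop) (f : Fin r → Var) :
    (relClauses R f).length ≤ 2 ^ r := by
  simpa [relClauses] using
    Finset.card_le_univ (Finset.univ.filter fun a : Fin r → Bool => ¬ R a)

theorem clauseVars_of_mem_relClauses {r : ℕ} {R : (Fin r → Bool) → Prop} {f : Fin r → Var}
    {c : Clause} (hc : c ∈ relClauses R f) : clauseVars c = Finset.univ.image f := by
  obtain ⟨a, -, rfl⟩ := List.mem_map.1 hc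
  simp [clauseVars, Finset.image_image, Function.comp_def]

theorem mem_cnfVars {φ : CNF} {x : Var} : x ∈ cnfVars φ ↔ ∃ c ∈ φ, x ∈ clauseVars c := by
  induction φ with
  | nil => simp [cnfVars]
  | cons c φ ih =>
    have h : cnfVars (c :: φ) = clauseVars c ∪ cnfVars φ := rfl
    simp [h, ih]

/-- One step of the bit-serial addition, without overflow on `m`-bit numbers, of the selected
weights. At time `k` the bit of index `k % m` of the weight of index `k / m` is added: `s` and
`s'` are the bits of the old and of the new partial sum, `c` and `c'` the incoming and the
outgoing carry, `x` and `x'` tell whether the weight is selected. The remaining conditions fix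
the initial sum `0`, the final sum `t` and the absence of carries across rows, keep the selection
constant along a row and forbid selecting weights that do not fit. -/
def AddStep (n m t : ℕ) (w : ℕ → ℕ) (k : ℕ) (s s' c c' x x' : Bool) : Prop :=
  s.toNat + c.toNat + x.toNat * (w (k / m) / 2 ^ (k % m) % 2) = s'.toNat + 2 * c'.toNat ∧
  (k < m → s = false) ∧
  (n * m ≤ k + m → s'.toNat = t / 2 ^ (k % m) % 2) ∧
  (m ∣ k → c = false) ∧
  (m ∣ k + 1 → c' = false) ∧
  (¬ m ∣ k + 1 → x' = x) ∧
  (2 ^ m ≤ w (k / m) → x = false)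

theorem sum_bits_eq_mod (a b : ℕ) :
    ∑ j ∈ Finset.range b, 2 ^ j * (a / 2 ^ j % 2) = a % 2 ^ b := by
  induction b with
  | zero => simp [Nat.mod_one]
  | succ b ih => rw [Finset.sum_range_succ, ih, Nat.mod_pow_succ]

/-- The carry into position `b` when adding `a` and `d`. -/
def carry (a d b : ℕ) : Bool := decide (2 ^ b ≤ a % 2 ^ b + d % 2 ^ b)

theorem mod_add_mod_eq_carry (a d b : ℕ) :
    a % 2 ^ b + d % 2 ^ b = (a + d) % 2 ^ b + 2 ^ b * (carry a d b).toNat := by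
  have hp : 0 < 2 ^ b := by positivity
  have ha := Nat.mod_lt a hp
  have hd := Nat.mod_lt d hp
  rw [Nat.add_mod a d]
  by_cases h : 2 ^ b ≤ a % 2 ^ b + d % 2 ^ b
  · rw [Nat.mod_eq_sub_mod h, Nat.mod_eq_of_lt (a := _ - _) (by omega)]
    simp only [carry, h, decide_true, Bool.toNat_true]
    omega
  · rw [Nat.mod_eq_of_lt (a := _ + _) (by omega)]
    simp [carry, h]

theorem bit_add_carry (a d b : ℕ) :
    a / 2 ^ b % 2 + (carry a d b).toNat + d / 2 ^ b % 2 =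
      (a + d) / 2 ^ b % 2 + 2 * (carry a d (b + 1)).toNat := by
  have h₀ := mod_add_mod_eq_carry a d b
  have h₁ := mod_add_mod_eq_carry a d (b + 1)
  rw [Nat.mod_pow_succ, Nat.mod_pow_succ, Nat.mod_pow_succ, pow_succ] at h₁
  have hp : 0 < 2 ^ b := by positivity
  apply Nat.eq_of_mul_eq_mul_left hp
  linarith

theorem sum_eq_of_addStep {n m t : ℕ} {w : ℕ → ℕ} (hn : 0 < n) (hm : 0 < m) (ht : t < 2 ^ m)
    {s c x : ℕ → Bool}
    (h : ∀ k < n * m, AddStep n m t w k (s k) (s (k + m)) (c k) (c (k + 1)) (x k) (x (k + 1))) :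
    ∑ i ∈ Finset.range n, (x (i * m)).toNat * w i = t := by
  have step (i : ℕ) (hi : i < n) (b : ℕ) (hb : b < m) := h (i * m + b) (by nlinarith)
  have hdiv (i b : ℕ) (hb : b < m) : (i * m + b) / m = i := by
    rw [mul_comm, Nat.mul_add_div hm, Nat.div_eq_of_lt hb, add_zero]
  have hmod (i b : ℕ) (hb : b < m) : (i * m + b) % m = b := by
    rw [mul_comm, Nat.mul_add_mod, Nat.mod_eq_of_lt hb]
  have hx (i : ℕ) (hi : i < n) (b : ℕ) (hb : b < m) : x (i * m + b) = x (i * m) := by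
    induction b with
    | zero => rfl
    | succ b ih =>
      rw [← ih (by omega)]
      refine (step i hi b (by omega)).2.2.2.2.2.1 ?_
      rw [add_assoc, Nat.dvd_add_right (Nat.dvd_mul_left m i)]
      exact Nat.not_dvd_of_pos_of_lt (by omega) hb
  let val (i b : ℕ) : ℕ := ∑ j ∈ Finset.range b, 2 ^ j * (s (i * m + j)).toNat
  have hval (i : ℕ) (hi : i < n) (b : ℕ) (hb : b ≤ m) :
      val i b + (x (i * m)).toNat * (w i % 2 ^ b) =
        val (i + 1) b + 2 ^ b * (c (i * m + b)).toNat := by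
    induction b with
    | zero =>
      have := (step i hi 0 hm).2.2.2.1 (by simp)
      rw [this]
      simp [val, Nat.mod_one]
    | succ b ih =>
      have e := (step i hi b (by omega)).1
      rw [hdiv i b (by omega), hmod i b (by omega), hx i hi b (by omega),
        show i * m + b + m = (i + 1) * m + b by ring] at e
      have ih := ih (by omega)
      simp only [val] at ih ⊢
      rw [Finset.sum_range_succ, Finset.sum_range_succ, Nat.mod_pow_succ, pow_succ, ← add_assoc]
      linear_combination ih + 2 ^ b * e
  have hrow (i : ℕ) (hi : i < n) : val i m + (x (i * m)).toNat * w i = val (i + 1) m := by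
    have e := hval i hi m le_rfl
    have st := step i hi (m - 1) (by omega)
    have hc := st.2.2.2.2.1
    have hk : i * m + (m - 1) + 1 = i * m + m := by omega
    rw [hk] at hc
    rw [hc (by simp)] at e
    have hw : (x (i * m)).toNat * (w i % 2 ^ m) = (x (i * m)).toNat * w i := by
      by_cases hlt : w i < 2 ^ m
      · rw [Nat.mod_eq_of_lt hlt]
      · have := (step i hi 0 hm).2.2.2.2.2.2
        rw [hdiv i 0 hm] at this
        have := this (by omega)
        simp only [add_zero] at this
        simp [this]
    rw [hw] at e
    simpa using e
  have hprefix (i : ℕ) (hi : i ≤ n) :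
      ∑ j ∈ Finset.range i, (x (j * m)).toNat * w j = val i m := by
    induction i with
    | zero =>
      rw [Finset.sum_range_zero]
      refine (Finset.sum_eq_zero fun j hj => ?_).symm
      have hj := Finset.mem_range.1 hj
      have := (step 0 hn j hj).2.1 (by omega)
      rw [this]
      simp
    | succ i ih => rw [Finset.sum_range_succ, ih (by omega), hrow i (by omega)]
  rw [hprefix n le_rfl, ← Nat.mod_eq_of_lt ht, ← sum_bits_eq_mod]
  refine Finset.sum_congr rfl fun j hj => ?_
  have hj := Finset.mem_range.1 hj
  obtain ⟨n, rfl⟩ := Nat.exists_eq_add_one.2 hn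
  have := (step n (by omega) j hj).2.2.1 (by rw [add_mul]; omega)
  rw [hmod n j hj, show n * m + j + m = (n + 1) * m + j by ring] at this
  rw [this]

theorem exists_addStep {n m t : ℕ} {w : ℕ → ℕ} (hm : 0 < m) (ht : t < 2 ^ m)
    {y : ℕ → Bool} (hy : ∑ i ∈ Finset.range n, (y i).toNat * w i = t) :
    ∃ s c x : ℕ → Bool, ∀ k < n * m,
      AddStep n m t w k (s k) (s (k + m)) (c k) (c (k + 1)) (x k) (x (k + 1)) := by
  let d (i : ℕ) : ℕ := (y i).toNat * w i
  let P (i : ℕ) : ℕ := ∑ j ∈ Finset.range i, d j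
  have hP (i : ℕ) (hi : i ≤ n) : P i < 2 ^ m := by
    refine lt_of_le_of_lt ?_ ht
    rw [← hy]
    exact Finset.sum_le_sum_of_subset (Finset.range_mono hi)
  have hPs (i : ℕ) : P (i + 1) = P i + d i := Finset.sum_range_succ _ _
  have hcarry (i : ℕ) (hi : i < n) : carry (P i) (d i) m = false := by
    have := hP (i + 1) hi
    rw [hPs] at this
    rw [carry, Nat.mod_eq_of_lt (by omega), Nat.mod_eq_of_lt (by omega)]
    simpa using this
  have hcarry0 (a b : ℕ) : carry a b 0 = false := by simp [carry, Nat.mod_one]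
  refine ⟨fun k => (P (k / m)).testBit (k % m),
    fun k => carry (P (k / m)) (d (k / m)) (k % m), fun k => y (k / m), fun k hk => ?_⟩
  have hi : k / m < n := Nat.div_lt_of_lt_mul (by rwa [mul_comm])
  have hkm : k % m < m := Nat.mod_lt _ hm
  have hk' := Nat.div_add_mod k m
  have hnext : ¬ m ∣ k + 1 → (k + 1) / m = k / m ∧ (k + 1) % m = k % m + 1 := by
    intro hd
    have hlt : k % m + 1 < m := by
      by_contra hge
      refine hd ⟨k / m + 1, ?_⟩
      rw [mul_add]
      omega
    exact (Nat.div_mod_unique hm).2 ⟨by omega, hlt⟩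
  have hout : (carry (P ((k + 1) / m)) (d ((k + 1) / m)) ((k + 1) % m)) =
      carry (P (k / m)) (d (k / m)) (k % m + 1) := by
    by_cases hd : m ∣ k + 1
    · have hlast : k % m + 1 = m := by
        have h₁ : m ∣ k % m + 1 := by
          rw [← Nat.dvd_add_right (Nat.dvd_mul_right m (k / m))]
          rwa [← add_assoc, hk']
        have := Nat.le_of_dvd (by omega) h₁
        omega
      rw [Nat.mod_eq_zero_of_dvd hd, hcarry0, hlast, hcarry _ hi]
    · rw [(hnext hd).1, (hnext hd).2]
  have hbit : (y (k / m)).toNat * (w (k / m) / 2 ^ (k % m) % 2) =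
      d (k / m) / 2 ^ (k % m) % 2 := by
    cases h : y (k / m) <;> simp [d, h]
  refine ⟨?_, ?_, ?_, ?_, ?_, ?_, ?_⟩
  · simp only [Nat.toNat_testBit, Nat.add_div_right k hm, Nat.add_mod_right, hout, hbit]
    rw [bit_add_carry, hPs]
  · intro h
    simp [Nat.div_eq_of_lt h, P]
  · intro h
    have hlast : k / m + 1 = n := by
      have : n ≤ (k + m) / m := (Nat.le_div_iff_mul_le hm).2 h
      rw [Nat.add_div_right k hm] at this
      omega
    simp only [Nat.toNat_testBit, Nat.add_div_right k hm, Nat.add_mod_right, hlast]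
    rw [← hy]
  · intro h
    simp only [Nat.mod_eq_zero_of_dvd h, hcarry0]
  · intro h
    simp only [Nat.mod_eq_zero_of_dvd h, hcarry0]
  · intro h
    simp only [(hnext h).1]
  · intro h
    by_contra hyk
    have h₁ := hP (k / m + 1) hi
    rw [hPs] at h₁
    simp only [Bool.not_eq_false] at hyk
    simp only [d, hyk, Bool.toNat_true] at h₁
    omega

/-- The variables taking part in the addition step at time `k`: sum bits are the multiples of
`3`, carries and selection bits the numbers congruent to `1` and `2`. -/
def stepVars (m k : ℕ) : Fin 6 → Var :=
  ![3 * k, 3 * (k + m), 3 * k + 1, 3 * (k + 1) + 1, 3 * k + 2, 3 * (k + 1) + 2]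

/-- The formula describing the addition of `n` weights on `m`-bit numbers with result `t`. -/
noncomputable def sumCNF (n m t : ℕ) (w : ℕ → ℕ) : CNF :=
  (List.range (n * m)).flatMap fun k =>
    relClauses (fun a => AddStep n m t w k (a 0) (a 1) (a 2) (a 3) (a 4) (a 5)) (stepVars m k)

/-- The variables alive at time `k`. -/
def liveVars (m k : ℕ) : Finset ℕ :=
  (Finset.Icc k (k + m)).image (3 * ·) ∪
    {3 * k + 1, 3 * (k + 1) + 1, 3 * k + 2, 3 * (k + 1) + 2}

theorem image_stepVars_subset (m k : ℕ) : Finset.univ.image (stepVars m k) ⊆ liveVars m k := by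
  intro x hx
  obtain ⟨j, -, rfl⟩ := Finset.mem_image.1 hx
  fin_cases j <;> simp [stepVars, liveVars]

theorem card_liveVars_le (m k : ℕ) : (liveVars m k).card ≤ m + 5 := by
  refine (Finset.card_union_le _ _).trans ?_
  have h₁ : ((Finset.Icc k (k + m)).image (3 * ·)).card ≤ m + 1 :=
    Finset.card_image_le.trans (by rw [Nat.card_Icc]; omega)
  have h₂ : ({3 * k + 1, 3 * (k + 1) + 1, 3 * k + 2, 3 * (k + 1) + 2} : Finset ℕ).card ≤ 4 :=
    Finset.card_le_four
  omega

theorem mem_liveVars_of_le_of_le {m i j k x : ℕ} (hij : i ≤ j) (hjk : j ≤ k)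
    (hi : x ∈ liveVars m i) (hk : x ∈ liveVars m k) : x ∈ liveVars m j := by
  simp only [liveVars, Finset.mem_union, Finset.mem_image, Finset.mem_Icc, Finset.mem_insert,
    Finset.mem_singleton] at *
  by_cases h : 3 ∣ x
  · left
    refine ⟨x / 3, ?_, by omega⟩
    rcases hi with ⟨q, hq, rfl⟩ | hi
    · rcases hk with ⟨q', hq', e⟩ | hk <;> omega
    · omega
  · right
    rcases hi with ⟨q, hq, rfl⟩ | hi
    · omega
    · rcases hk with ⟨q', hq', e⟩ | hk <;> omega

theorem mem_sumCNF_clauseVars {n m t : ℕ} {w : ℕ → ℕ} {c : Clause} (hc : c ∈ sumCNF n m t w) :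
    ∃ k < n * m, clauseVars c ⊆ liveVars m k := by
  obtain ⟨k, hk, hc⟩ := List.mem_flatMap.1 hc
  refine ⟨k, List.mem_range.1 hk, ?_⟩
  rw [clauseVars_of_mem_relClauses hc]
  exact image_stepVars_subset m k

theorem length_sumCNF_le (n m t : ℕ) (w : ℕ → ℕ) : (sumCNF n m t w).length ≤ 64 * (n * m) := by
  rw [sumCNF, List.length_flatMap]
  refine (List.sum_le_card_nsmul _ 64 ?_).trans (by simp [mul_comm 64])
  intro l hl
  obtain ⟨k, -, rfl⟩ := List.mem_map.1 hl
  exact length_relClauses_le _ _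

theorem card_cnfVars_sumCNF_le {n m t : ℕ} {w : ℕ → ℕ} (hn : 0 < n) (hm : 0 < m) :
    (cnfVars (sumCNF n m t w)).card ≤ 9 * (n * m) := by
  have hmn : m ≤ n * m := Nat.le_mul_of_pos_left m hn
  have hsub : cnfVars (sumCNF n m t w) ⊆ Finset.range (9 * (n * m)) := by
    intro (x : ℕ) hx
    obtain ⟨c, hc, hx⟩ := mem_cnfVars.1 hx
    obtain ⟨k, hk, hsub⟩ := mem_sumCNF_clauseVars hc
    have : x ∈ liveVars m k := hsub hx
    simp only [liveVars, Finset.mem_union, Finset.mem_image, Finset.mem_Icc, Finset.mem_insert,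
      Finset.mem_singleton] at this
    rw [Finset.mem_range]
    rcases this with ⟨q, hq, rfl⟩ | h <;> omega
  simpa using Finset.card_le_card hsub

theorem satisfiable_sumCNF_iff {n m t : ℕ} {w : ℕ → ℕ} (hn : 0 < n) (hm : 0 < m)
    (ht : t < 2 ^ m) :
    Satisfiable (sumCNF n m t w) ↔
      ∃ y : ℕ → Bool, ∑ i ∈ Finset.range n, (y i).toNat * w i = t := by
  have hsat (τ : Var → Bool) : Sat τ (sumCNF n m t w) ↔ ∀ k < n * m, AddStep n m t w k
      (τ (3 * k)) (τ (3 * (k + m))) (τ (3 * k + 1)) (τ (3 * (k + 1) + 1))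
      (τ (3 * k + 2)) (τ (3 * (k + 1) + 2)) := by
    have hrel (k : ℕ) := sat_relClauses
      (fun a => AddStep n m t w k (a 0) (a 1) (a 2) (a 3) (a 4) (a 5)) (stepVars m k) τ
    constructor
    · intro h k hk
      exact (hrel k).1 fun c hc => h c (List.mem_flatMap.2 ⟨k, List.mem_range.2 hk, hc⟩)
    · intro h c hc
      obtain ⟨k, hk, hc⟩ := List.mem_flatMap.1 hc
      exact (hrel k).2 (h k (List.mem_range.1 hk)) c hc
  constructor
  · rintro ⟨τ, hτ⟩
    exact ⟨fun i => τ (3 * (i * m) + 2),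
      sum_eq_of_addStep (s := fun k => τ (3 * k)) (c := fun k => τ (3 * k + 1))
        (x := fun k => τ (3 * k + 2)) hn hm ht ((hsat τ).1 hτ)⟩
  · rintro ⟨y, hy⟩
    obtain ⟨s, c, x, h⟩ := exists_addStep hm ht hy
    refine ⟨fun z => if z % 3 = 0 then s (z / 3) else if z % 3 = 1 then c (z / 3) else x (z / 3),
      (hsat _).2 fun k hk => ?_⟩
    have h₁ (q : ℕ) : (3 * q + 1) / 3 = q := by omega
    have h₂ (q : ℕ) : (3 * q + 2) / 3 = q := by omega
    simpa [Nat.mul_add_mod, h₁, h₂] using h k hk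

theorem PDOn_map_range_inter {φ : CNF} {N : ℕ} {V : ℕ → Finset Var}
    (hcover : ∀ c ∈ φ, ∃ k < N, clauseVars c ⊆ V k)
    (hinterval : ∀ x i j k, i ≤ j → j ≤ k → x ∈ V i → x ∈ V k → x ∈ V j) :
    PDOn φ ((List.range N).map fun k => V k ∩ cnfVars φ) := by
  have hclause : ∀ c ∈ φ, ∃ b ∈ (List.range N).map fun k => V k ∩ cnfVars φ,
      clauseVars c ⊆ b := by
    intro c hc
    obtain ⟨k, hk, hsub⟩ := hcover c hc
    exact ⟨_, List.mem_map.2 ⟨k, List.mem_range.2 hk, rfl⟩,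
      Finset.subset_inter hsub fun x hx => mem_cnfVars.2 ⟨c, hc, hx⟩⟩
  have hmem (x j : ℕ) : x ∈ ((List.range N).map fun k => V k ∩ cnfVars φ).getD j ∅ ↔
      j < N ∧ x ∈ V j ∧ x ∈ cnfVars φ := by
    by_cases hj : j < N <;> simp [List.getD_eq_getElem?_getD, hj]
  refine ⟨?_, ?_, hclause, ?_⟩
  · intro b hb
    obtain ⟨k, -, rfl⟩ := List.mem_map.1 hb
    exact Finset.inter_subset_right
  · intro x hx
    obtain ⟨c, hc, hxc⟩ := mem_cnfVars.1 hx
    obtain ⟨b, hb, hsub⟩ := hclause c hc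
    exact ⟨b, hb, hsub hxc⟩
  · intro x i j k hij hjk hi hk
    rw [hmem] at *
    exact ⟨by omega, hinterval x i j k hij hjk hi.2.1 hk.2.1, hi.2.2⟩

theorem exists_finset_sum_iff {n : ℕ} (v : Fin n → ℕ) (t : ℕ) :
    (∃ I : Finset (Fin n), ∑ i ∈ I, v i = t) ↔
      ∃ y : ℕ → Bool, ∑ i ∈ Finset.range n,
        (y i).toNat * (if h : i < n then v ⟨i, h⟩ else 0) = t := by
  simp only [Finset.sum_range, Fin.is_lt, dite_true, Fin.eta]
  constructor
  · rintro ⟨I, rfl⟩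
    refine ⟨fun i => decide (∃ h : i < n, (⟨i, h⟩ : Fin n) ∈ I), ?_⟩
    rw [← Finset.sum_filter_add_sum_filter_not Finset.univ (· ∈ I)]
    rw [Finset.sum_eq_zero (s := Finset.univ.filter (· ∉ I))
      fun i hi => by simp [(Finset.mem_filter.1 hi).2], add_zero, Finset.filter_univ_mem]
    exact Finset.sum_congr rfl fun i hi => by simp [hi]
  · rintro ⟨y, rfl⟩
    refine ⟨Finset.univ.filter fun i => y i = true, ?_⟩
    rw [Finset.sum_filter]
    refine Finset.sum_congr rfl fun i _ => ?_
    cases y i <;> simp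

/-- There is an absolute constant `C` such that: for every sequence
`v₁, …, v_n` of positive integers (`n ≥ 1`) and every positive integer `t`, there is a
CNF formula `ψ` with at most `C·n·(⌈log₂ t⌉ + 1)` variables and clauses, together with a
path decomposition of `ψ` of width at most `⌈log₂ t⌉ + C`, such that `ψ` is satisfiable
iff some subset of the `vᵢ` sums to exactly `t`. -/
theorem stmt11 : ∃ C : ℕ, ∀ (n : ℕ) (v : Fin n → ℕ) (t : ℕ),
    1 ≤ n → (∀ i, 0 < v i) → 0 < t →
    ∃ (ψ : CNF) (B : List (Finset Var)),
      (cnfVars ψ).card ≤ C * n * (Nat.clog 2 t + 1) ∧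
      ψ.length ≤ C * n * (Nat.clog 2 t + 1) ∧
      PD ψ (Nat.clog 2 t + C) B ∧
      (Satisfiable ψ ↔ ∃ I : Finset (Fin n), ∑ i ∈ I, v i = t) := by
  refine ⟨64, fun n v t hn _ _ => ?_⟩
  let w : ℕ → ℕ := fun i => if h : i < n then v ⟨i, h⟩ else 0
  let m := Nat.clog 2 t + 1
  have hm : 0 < m := Nat.succ_pos _
  have ht : t < 2 ^ m :=
    (Nat.le_pow_clog one_lt_two t).trans_lt (Nat.pow_lt_pow_right one_lt_two (Nat.lt_succ_self _))
  refine ⟨sumCNF n m t w, (List.range (n * m)).map fun k =>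
    liveVars m k ∩ cnfVars (sumCNF n m t w), ?_, ?_, ⟨?_, ?_⟩, ?_⟩
  · rw [mul_assoc]
    exact (card_cnfVars_sumCNF_le hn hm).trans (Nat.mul_le_mul_right _ (by norm_num))
  · rw [mul_assoc]
    exact length_sumCNF_le n m t w
  · exact PDOn_map_range_inter (fun c hc => mem_sumCNF_clauseVars hc)
      fun x i j k hij hjk hi hk => mem_liveVars_of_le_of_le hij hjk hi hk
  · intro b hb
    obtain ⟨k, -, rfl⟩ := List.mem_map.1 hb
    refine (Finset.card_le_card Finset.inter_subset_left).trans ?_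
    exact (card_liveVars_le m k).trans (by omega)
  · rw [satisfiable_sumCNF_iff hn hm ht, exists_finset_sum_iff]

end PPSETH
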